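/- arXiv:1308.3317 — 5 statements merged into one kernel-verified Lean document; each statement's English description precedes it below -/
import Mathlib

section
/- Under Assumption A, V is a constant of motion for the Goodwin system: if (x_t, y_t) is a differentiable curve taking values in D := (0,∞) × (0,1) on an interval I containing 0 and satisfying x'_t = x_t(Φ(y_t) − α) and y'_t = y_t(κ(x_t) − γ) on I, then V(x_t, y_t) = V(x_0, y_0) for all t ∈ I; in particular the trajectory is contained in the level set {(x,y) ∈ D : V(x,y) = V(x_0,y_0)}. -/
open Set Filter MeasureTheory intervalIntegral Real

noncomputable def V1 (κ : ℝ → ℝ) (xh : ℝ) (x : ℝ) : ℝ := ∫ s in xh..x, (κ xh - κ s) / s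

noncomputable def V2 (Φ : ℝ → ℝ) (yh : ℝ) (y : ℝ) : ℝ := ∫ s in yh..y, (Φ s - Φ yh) / s

theorem ftc_aux (f : ℝ → ℝ) (U : Set ℝ) (hU : IsOpen U) (hc : U.OrdConnected)
    (hf : ContinuousOn f U) (a b : ℝ) (ha : a ∈ U) (hb : b ∈ U) :
    HasDerivAt (fun u => ∫ s in a..u, f s) (f b) b := by
  apply intervalIntegral.integral_hasDerivAt_right
  · exact (hf.mono (hc.uIcc_subset ha hb)).intervalIntegrable
  · exact hf.stronglyMeasurableAtFilter hU b hb
  · exact hf.continuousAt (hU.mem_nhds hb)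

theorem V_constant_of_motion
    (α γ : ℝ) (Φ Φ' Φ'' κ κ' κ'' : ℝ → ℝ)
    (hΦd : ∀ y ∈ Set.Ico (0:ℝ) 1, HasDerivAt Φ (Φ' y) y)
    (hΦd2 : ∀ y ∈ Set.Ico (0:ℝ) 1, HasDerivAt Φ' (Φ'' y) y)
    (hΦc : ContinuousOn Φ'' (Set.Ico (0:ℝ) 1))
    (hΦpos : ∀ y ∈ Set.Ico (0:ℝ) 1, 0 < Φ' y)
    (hΦconv : ∀ y ∈ Set.Ico (0:ℝ) 1, 0 ≤ Φ'' y)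
    (hΦ0 : Φ 0 < α)
    (hΦtop : Filter.Tendsto Φ (nhdsWithin 1 (Set.Iio 1)) Filter.atTop)
    (hκd : ∀ x ∈ Set.Ici (0:ℝ), HasDerivAt κ (κ' x) x)
    (hκd2 : ∀ x ∈ Set.Ici (0:ℝ), HasDerivAt κ' (κ'' x) x)
    (hκc : ContinuousOn κ'' (Set.Ici (0:ℝ)))
    (hκneg : ∀ x ∈ Set.Ici (0:ℝ), κ' x < 0)
    (hκ0 : γ < κ 0)
    (hκbot : Filter.Tendsto κ Filter.atTop Filter.atBot)
    (xh : ℝ) (hxh0 : 0 < xh) (hxh : κ xh = γ)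
    (yh : ℝ) (hyh0 : yh ∈ Set.Ioo (0:ℝ) 1) (hyh : Φ yh = α)
    (x y : ℝ → ℝ) (I : Set ℝ) (hI : I.OrdConnected) (h0I : (0:ℝ) ∈ I)
    (hD : ∀ t ∈ I, x t ∈ Set.Ioi (0:ℝ) ∧ y t ∈ Set.Ioo (0:ℝ) 1)
    (hx : ∀ t ∈ I, HasDerivWithinAt x (x t * (Φ (y t) - α)) I t)
    (hy : ∀ t ∈ I, HasDerivWithinAt y (y t * (κ (x t) - γ)) I t) :
    ∀ t ∈ I,
      V1 κ xh (x t) + V2 Φ yh (y t) = V1 κ xh (x 0) + V2 Φ yh (y 0) ∧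
      (x t, y t) ∈ {p : ℝ × ℝ | p ∈ Set.Ioi (0:ℝ) ×ˢ Set.Ioo (0:ℝ) 1 ∧
        V1 κ xh p.1 + V2 Φ yh p.2 = V1 κ xh (x 0) + V2 Φ yh (y 0)} := by
  have h1 : ∀ b ∈ Set.Ioi (0:ℝ), HasDerivAt (V1 κ xh) ((κ xh - κ b) / b) b := by
    intro b hb
    refine ftc_aux (fun s => (κ xh - κ s) / s) (Set.Ioi 0) isOpen_Ioi ordConnected_Ioi ?_ xh b hxh0 hb
    refine ContinuousOn.div (continuousOn_const.sub ?_) continuousOn_id (fun s hs => ne_of_gt hs)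
    intro s hs
    exact (hκd s (Set.Ioi_subset_Ici_self hs)).continuousAt.continuousWithinAt
  have h2 : ∀ b ∈ Set.Ioo (0:ℝ) 1, HasDerivAt (V2 Φ yh) ((Φ b - Φ yh) / b) b := by
    intro b hb
    refine ftc_aux (fun s => (Φ s - Φ yh) / s) (Set.Ioo 0 1) isOpen_Ioo ordConnected_Ioo ?_ yh b hyh0 hb
    refine ContinuousOn.div (ContinuousOn.sub ?_ continuousOn_const) continuousOn_id
      (fun s hs => ne_of_gt hs.1)
    intro s hs
    exact (hΦd s ⟨hs.1.le, hs.2⟩).continuousAt.continuousWithinAt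
  have h3 : ∀ t ∈ I, HasDerivWithinAt (fun t => V1 κ xh (x t) + V2 Φ yh (y t)) 0 I t := by
    intro t ht
    obtain ⟨hxt, hyt⟩ := hD t ht
    have e := ((h1 _ hxt).comp_hasDerivWithinAt t (hx t ht)).add
      ((h2 _ hyt).comp_hasDerivWithinAt t (hy t ht))
    refine e.congr_deriv ?_
    have a1 : x t ≠ 0 := ne_of_gt hxt
    have a2 : y t ≠ 0 := ne_of_gt hyt.1
    rw [hxh, hyh]
    field_simp
    ring
  have h4 : ∀ t ∈ I, V1 κ xh (x t) + V2 Φ yh (y t) = V1 κ xh (x 0) + V2 Φ yh (y 0) := by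
    intro t ht
    have := hI.convex.norm_image_sub_le_of_norm_hasDerivWithin_le (C := 0) h3
      (fun _ _ => by simp) h0I ht
    rw [zero_mul] at this
    exact sub_eq_zero.mp (norm_le_zero_iff.mp this)
  intro t ht
  exact ⟨h4 t ht, ⟨(hD t ht).1, (hD t ht).2⟩, h4 t ht⟩
end

section
/- Under Assumption A, the domain D is forward invariant for the Goodwin system: if (x_t, y_t) is a differentiable curve on [0, T) with (x_0, y_0) ∈ D := (0,∞) × (0,1), taking values in D on some initial subinterval and satisfying x'_t = x_t(Φ(y_t) − α), y'_t = y_t(κ(x_t) − γ) wherever it lies in D, then (x_t, y_t) ∈ D for all t ∈ [0, T), and in fact the trajectory stays in the compact set {(x,y) ∈ D : V(x,y) ≤ V(x_0,y_0)}. -/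
open Set Filter MeasureTheory intervalIntegral Real

lemma gw_pos {f f' : ℝ → ℝ} {b c : ℝ} (hb : 0 < b) (hf : ContinuousOn f (Icc 0 b))
    (hd : ∀ t ∈ Ioo 0 b, HasDerivAt f (f' t) t) (hc : ∀ t ∈ Ioo 0 b, c * f t ≤ f' t)
    (h0 : 0 < f 0) : 0 < f b := by
  have hmono : MonotoneOn (fun t => f t * Real.exp (-c * t)) (Icc 0 b) := by
    have hdd : ∀ t ∈ Ioo 0 b, HasDerivAt (fun t => f t * Real.exp (-c * t))
        (f' t * Real.exp (-c * t) + f t * (Real.exp (-c * t) * (-c * 1))) t := fun t ht =>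
      (hd t ht).mul (((hasDerivAt_id t).const_mul (-c)).exp)
    apply monotoneOn_of_deriv_nonneg (convex_Icc 0 b)
    · exact hf.mul (by fun_prop)
    · rw [interior_Icc]
      exact fun t ht => (hdd t ht).differentiableAt.differentiableWithinAt
    · rw [interior_Icc]
      intro t ht
      rw [(hdd t ht).deriv]
      have := hc t ht
      have he := Real.exp_pos (-c * t)
      nlinarith [mul_nonneg (sub_nonneg.2 this) he.le]
  have h := hmono (left_mem_Icc.2 hb.le) (right_mem_Icc.2 hb.le) hb.le
  simp only [mul_zero, Real.exp_zero, mul_one] at h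
  exact pos_of_mul_pos_left (h0.trans_le h) (Real.exp_pos _).le

lemma gw_ftc {g : ℝ → ℝ} {S : Set ℝ} (hS : IsOpen S) (hc : OrdConnected S)
    (hg : ContinuousOn g S) {a b : ℝ} (ha : a ∈ S) (hb : b ∈ S) :
    HasDerivAt (fun u => ∫ s in a..u, g s) (g b) b := by
  apply intervalIntegral.integral_hasDerivAt_right
  · exact (hg.mono (hc.uIcc_subset ha hb)).intervalIntegrable
  · exact hg.stronglyMeasurableAtFilter hS b hb
  · exact hg.continuousAt (hS.mem_nhds hb)

theorem goodwin_forward_invariance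
    (α γ : ℝ) (Φ Φ' Φ'' κ κ' κ'' : ℝ → ℝ)
    (hΦd : ∀ y ∈ Set.Ico (0:ℝ) 1, HasDerivAt Φ (Φ' y) y)
    (hΦd2 : ∀ y ∈ Set.Ico (0:ℝ) 1, HasDerivAt Φ' (Φ'' y) y)
    (hΦc : ContinuousOn Φ'' (Set.Ico (0:ℝ) 1))
    (hΦpos : ∀ y ∈ Set.Ico (0:ℝ) 1, 0 < Φ' y)
    (hΦconv : ∀ y ∈ Set.Ico (0:ℝ) 1, 0 ≤ Φ'' y)
    (hΦ0 : Φ 0 < α)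
    (hΦtop : Filter.Tendsto Φ (nhdsWithin 1 (Set.Iio 1)) Filter.atTop)
    (hκd : ∀ x ∈ Set.Ici (0:ℝ), HasDerivAt κ (κ' x) x)
    (hκd2 : ∀ x ∈ Set.Ici (0:ℝ), HasDerivAt κ' (κ'' x) x)
    (hκc : ContinuousOn κ'' (Set.Ici (0:ℝ)))
    (hκneg : ∀ x ∈ Set.Ici (0:ℝ), κ' x < 0)
    (hκ0 : γ < κ 0)
    (hκbot : Filter.Tendsto κ Filter.atTop Filter.atBot)
    (xh : ℝ) (hxh0 : 0 < xh) (hxh : κ xh = γ)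
    (yh : ℝ) (hyh0 : yh ∈ Set.Ioo (0:ℝ) 1) (hyh : Φ yh = α)
    (T : ℝ) (hT : 0 < T) (x y : ℝ → ℝ)
    (hD0 : x 0 ∈ Set.Ioi (0:ℝ) ∧ y 0 ∈ Set.Ioo (0:ℝ) 1)
    (hdiff : ∀ t ∈ Set.Ico (0:ℝ) T,
      DifferentiableWithinAt ℝ x (Set.Ico (0:ℝ) T) t ∧
      DifferentiableWithinAt ℝ y (Set.Ico (0:ℝ) T) t)
    (hinit : ∃ ε > (0:ℝ), ∀ t ∈ Set.Ico (0:ℝ) T, t < ε →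
      x t ∈ Set.Ioi (0:ℝ) ∧ y t ∈ Set.Ioo (0:ℝ) 1)
    (hode : ∀ t ∈ Set.Ico (0:ℝ) T,
      (x t ∈ Set.Ioi (0:ℝ) ∧ y t ∈ Set.Ioo (0:ℝ) 1) →
      HasDerivWithinAt x (x t * (Φ (y t) - α)) (Set.Ico (0:ℝ) T) t ∧
      HasDerivWithinAt y (y t * (κ (x t) - γ)) (Set.Ico (0:ℝ) T) t) :
    ∀ t ∈ Set.Ico (0:ℝ) T,
      (x t ∈ Set.Ioi (0:ℝ) ∧ y t ∈ Set.Ioo (0:ℝ) 1) ∧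
      V1 κ xh (x t) + V2 Φ yh (y t) ≤ V1 κ xh (x 0) + V2 Φ yh (y 0) := by
  have hκcont : ContinuousOn κ (Ici 0) := fun u hu => (hκd u hu).continuousAt.continuousWithinAt
  have hΦcont : ContinuousOn Φ (Ico 0 1) := fun u hu => (hΦd u hu).continuousAt.continuousWithinAt
  have hΦmono : MonotoneOn Φ (Ico 0 1) := by
    apply monotoneOn_of_deriv_nonneg (convex_Ico 0 1) hΦcont
    · exact fun u hu => (hΦd u (interior_subset hu)).differentiableAt.differentiableWithinAt
    · intro u hu
      rw [(hΦd u (interior_subset hu)).deriv]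
      exact (hΦpos u (interior_subset hu)).le
  have hxc : ContinuousOn x (Ico 0 T) := fun t ht => (hdiff t ht).1.continuousWithinAt
  have hyc : ContinuousOn y (Ico 0 T) := fun t ht => (hdiff t ht).2.continuousWithinAt
  have hnb : ∀ t ∈ Ioo 0 T, Ico 0 T ∈ nhds t := fun t ht => Ico_mem_nhds ht.1 ht.2
  have key : ∀ t ∈ Ico 0 T, x t ∈ Ioi (0:ℝ) ∧ y t ∈ Ioo (0:ℝ) 1 := by
    by_contra hcon
    push Not at hcon
    set S : Set ℝ := {t | t ∈ Ico 0 T ∧ ¬ (x t ∈ Ioi (0:ℝ) ∧ y t ∈ Ioo (0:ℝ) 1)} with hSdef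
    have hSne : S.Nonempty := by
      obtain ⟨t, ht, h⟩ := hcon
      exact ⟨t, ht, fun h' => h h'.1 h'.2⟩
    have hSb : BddBelow S := ⟨0, fun t ht => ht.1.1⟩
    set b := sInf S with hbdef
    have hbT : b < T := by
      obtain ⟨t, ht⟩ := hSne
      exact (csInf_le hSb ht).trans_lt ht.1.2
    have hb0' : 0 ≤ b := le_csInf hSne fun t ht => ht.1.1
    have hlt : ∀ t ∈ Ico 0 b, x t ∈ Ioi (0:ℝ) ∧ y t ∈ Ioo (0:ℝ) 1 := by
      intro t ht
      by_contra h
      exact absurd (csInf_le hSb (show t ∈ S from ⟨⟨ht.1, ht.2.trans hbT⟩, h⟩)) (not_le.2 ht.2)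
    have hbS : ¬ (x b ∈ Ioi (0:ℝ) ∧ y b ∈ Ioo (0:ℝ) 1) := by
      intro h
      have h1 := (hxc b ⟨hb0', hbT⟩).eventually (isOpen_Ioi.mem_nhds h.1)
      have h2 := (hyc b ⟨hb0', hbT⟩).eventually (isOpen_Ioo.mem_nhds h.2)
      obtain ⟨δ, hδ, hδ'⟩ := Metric.mem_nhdsWithin_iff.1 (h1.and h2)
      obtain ⟨t, ht, htb⟩ := exists_lt_of_csInf_lt hSne (show sInf S < b + δ by linarith)
      have hbt : b ≤ t := csInf_le hSb ht
      refine ht.2 (hδ' ⟨?_, ht.1⟩)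
      rw [Metric.mem_ball, Real.dist_eq, abs_lt]
      constructor <;> linarith
    have hb0 : 0 < b := by
      rcases hb0'.eq_or_lt with h | h
      · rw [← h] at hbS
        exact absurd hD0 hbS
      · exact h
    have hsub : Icc 0 b ⊆ Ico 0 T := fun t ht => ⟨ht.1, ht.2.trans_lt hbT⟩
    have hxb := hxc.mono hsub
    have hyb := hyc.mono hsub
    have hder : ∀ t ∈ Ioo 0 b, HasDerivAt x (x t * (Φ (y t) - α)) t ∧
        HasDerivAt y (y t * (κ (x t) - γ)) t := by
      intro t ht
      have htT : t ∈ Ioo 0 T := ⟨ht.1, ht.2.trans hbT⟩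
      have := hode t ⟨ht.1.le, htT.2⟩ (hlt t ⟨ht.1.le, ht.2⟩)
      exact ⟨this.1.hasDerivAt (hnb t htT), this.2.hasDerivAt (hnb t htT)⟩
    have hxpos : 0 < x b := by
      apply gw_pos (c := Φ 0 - α) hb0 hxb (fun t ht => (hder t ht).1) _ hD0.1
      intro t ht
      obtain ⟨h1, h2⟩ := hlt t ⟨ht.1.le, ht.2⟩
      have h1' : 0 < x t := h1
      have : Φ 0 ≤ Φ (y t) := hΦmono ⟨le_rfl, one_pos⟩ ⟨h2.1.le, h2.2⟩ h2.1.le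
      nlinarith
    have hxnn : MapsTo x (Icc 0 b) (Ici 0) := by
      intro t ht
      rcases ht.2.eq_or_lt with h | h
      · rw [h]; exact hxpos.le
      · exact Ioi_subset_Ici_self (hlt t ⟨ht.1, h⟩).1
    have hypos : 0 < y b := by
      obtain ⟨c, hc⟩ := (isCompact_Icc.image_of_continuousOn (hκcont.comp hxb hxnn)).bddBelow
      apply gw_pos (c := c - γ) hb0 hyb (fun t ht => (hder t ht).2) _ hD0.2.1
      intro t ht
      obtain ⟨h1, h2⟩ := hlt t ⟨ht.1.le, ht.2⟩
      have : c ≤ κ (x t) := hc ⟨t, ⟨ht.1.le, ht.2.le⟩, rfl⟩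
      nlinarith [h2.1]
    have hxcA : ContinuousAt x b := hxc.continuousAt (hnb b ⟨hb0, hbT⟩)
    have hycA : ContinuousAt y b := hyc.continuousAt (hnb b ⟨hb0, hbT⟩)
    have hIoo : Ioo 0 b ∈ nhdsWithin b (Iio b) := Ioo_mem_nhdsLT hb0
    have hyt : Tendsto y (nhdsWithin b (Iio b)) (nhds (y b)) := hycA.tendsto.mono_left inf_le_left
    have hxt : Tendsto x (nhdsWithin b (Iio b)) (nhds (x b)) := hxcA.tendsto.mono_left inf_le_left
    have hev : ∀ᶠ t in nhdsWithin b (Iio b), y t < 1 := by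
      filter_upwards [hIoo] with t ht using (hlt t ⟨ht.1.le, ht.2⟩).2.2
    have hyle : y b ≤ 1 := le_of_tendsto hyt (hev.mono fun _ h => h.le)
    have hy1 : y b = 1 := by
      by_contra h
      exact hbS ⟨hxpos, hypos, lt_of_le_of_ne hyle h⟩
    have hyt' : Tendsto y (nhdsWithin b (Iio b)) (nhdsWithin 1 (Iio 1)) :=
      tendsto_nhdsWithin_iff.2 ⟨hy1 ▸ hyt, hev⟩
    have htop : Tendsto (fun t => x t * (Φ (y t) - α)) (nhdsWithin b (Iio b)) atTop :=
      hxt.pos_mul_atTop hxpos (tendsto_atTop_add_const_right _ (-α) (hΦtop.comp hyt'))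
    have hdt : Tendsto (deriv x) (nhdsWithin b (Iio b)) atTop := by
      refine htop.congr' ?_
      filter_upwards [hIoo] with t ht using (hder t ht).1.deriv.symm
    refine not_differentiableWithinAt_of_deriv_tendsto_atTop_Iio x hdt ?_
    exact ((hdiff b ⟨hb0', hbT⟩).1.differentiableAt (hnb b ⟨hb0, hbT⟩)).differentiableWithinAt
  intro t ht
  refine ⟨key t ht, le_of_eq ?_⟩
  have hV1 : ∀ u ∈ Ioi (0:ℝ), HasDerivAt (V1 κ xh) ((κ xh - κ u) / u) u := fun u hu =>
    gw_ftc (g := fun s => (κ xh - κ s) / s) isOpen_Ioi ordConnected_Ioi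
      ((continuousOn_const.sub (hκcont.mono Ioi_subset_Ici_self)).div continuousOn_id
        fun s hs => ne_of_gt hs) hxh0 hu
  have hV2 : ∀ u ∈ Ioo (0:ℝ) 1, HasDerivAt (V2 Φ yh) ((Φ u - Φ yh) / u) u := fun u hu =>
    gw_ftc (g := fun s => (Φ s - Φ yh) / s) isOpen_Ioo ordConnected_Ioo
      (((hΦcont.mono Ioo_subset_Ico_self).sub continuousOn_const).div continuousOn_id
        fun s hs => ne_of_gt hs.1) hyh0 hu
  have hH : ∀ s ∈ Ico 0 T, HasDerivWithinAt (fun t => V1 κ xh (x t) + V2 Φ yh (y t)) 0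
      (Ico 0 T) s := by
    intro s hs
    obtain ⟨h1, h2⟩ := key s hs
    obtain ⟨d1, d2⟩ := hode s hs ⟨h1, h2⟩
    have := ((hV1 _ h1).comp_hasDerivWithinAt s d1).add ((hV2 _ h2).comp_hasDerivWithinAt s d2)
    refine this.congr_deriv ?_
    have h1' : x s ≠ 0 := ne_of_gt h1
    have h2' : y s ≠ 0 := ne_of_gt h2.1
    rw [hxh, hyh]
    field_simp
    ring
  have hsub : Icc 0 t ⊆ Ico 0 T := fun s hs => ⟨hs.1, hs.2.trans_lt ht.2⟩
  refine constant_of_has_deriv_right_zero (f := fun t => V1 κ xh (x t) + V2 Φ yh (y t))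
    (a := 0) (b := t) (fun s hs => ((hH s (hsub hs)).continuousWithinAt).mono hsub) ?_ t
    ⟨ht.1, le_rfl⟩
  intro s hs
  refine (hH s (hsub ⟨hs.1, hs.2.le⟩)).mono_of_mem_nhdsWithin ?_
  exact mem_of_superset (Ico_mem_nhdsGE (hs.2.trans ht.2))
    fun u hu => ⟨hs.1.trans hu.1, hu.2⟩
end

section
/- Under Assumption A, for every V₀ > 0 the equation V₁(x) = V₀ has exactly two solutions x̲ and x̄ in (0,∞), and they satisfy x̲ < x̂ < x̄. -/
open Set Filter MeasureTheory intervalIntegral Real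

theorem V1_level_two_solutions
    (α γ : ℝ) (Φ Φ' Φ'' κ κ' κ'' : ℝ → ℝ)
    (hΦd : ∀ y ∈ Set.Ico (0:ℝ) 1, HasDerivAt Φ (Φ' y) y)
    (hΦd2 : ∀ y ∈ Set.Ico (0:ℝ) 1, HasDerivAt Φ' (Φ'' y) y)
    (hΦc : ContinuousOn Φ'' (Set.Ico (0:ℝ) 1))
    (hΦpos : ∀ y ∈ Set.Ico (0:ℝ) 1, 0 < Φ' y)
    (hΦconv : ∀ y ∈ Set.Ico (0:ℝ) 1, 0 ≤ Φ'' y)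
    (hΦ0 : Φ 0 < α)
    (hΦtop : Filter.Tendsto Φ (nhdsWithin 1 (Set.Iio 1)) Filter.atTop)
    (hκd : ∀ x ∈ Set.Ici (0:ℝ), HasDerivAt κ (κ' x) x)
    (hκd2 : ∀ x ∈ Set.Ici (0:ℝ), HasDerivAt κ' (κ'' x) x)
    (hκc : ContinuousOn κ'' (Set.Ici (0:ℝ)))
    (hκneg : ∀ x ∈ Set.Ici (0:ℝ), κ' x < 0)
    (hκ0 : γ < κ 0)
    (hκbot : Filter.Tendsto κ Filter.atTop Filter.atBot)
    (xh : ℝ) (hxh0 : 0 < xh) (hxh : κ xh = γ)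
 :
    ∀ V₀ : ℝ, 0 < V₀ →
      ∃ xl xu : ℝ, xl ∈ Set.Ioo (0:ℝ) xh ∧ xu ∈ Set.Ioi xh ∧
        V1 κ xh xl = V₀ ∧ V1 κ xh xu = V₀ ∧
        ∀ x ∈ Set.Ioi (0:ℝ), V1 κ xh x = V₀ → x = xl ∨ x = xu := by
  intro V₀ hV
  have hanti : StrictAntiOn κ (Ici (0:ℝ)) := by
    apply strictAntiOn_of_deriv_neg (convex_Ici 0)
    · exact fun x hx => (hκd x hx).continuousAt.continuousWithinAt
    · intro x hx
      have hx' : x ∈ Ici (0:ℝ) := interior_subset hx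
      rw [(hκd x hx').deriv]
      exact hκneg x hx'
  have hcont : ContinuousOn (fun s => (κ xh - κ s) / s) (Ioi (0:ℝ)) := by
    intro x hx
    have hx' : (0:ℝ) < x := hx
    exact ((continuousAt_const.sub (hκd x hx'.le).continuousAt).div continuousAt_id
      hx'.ne').continuousWithinAt
  have hd : ∀ x, 0 < x → HasDerivAt (V1 κ xh) ((κ xh - κ x) / x) x := by
    intro x hx
    have hsub : uIcc xh x ⊆ Ioi (0:ℝ) := by
      intro y hy
      exact lt_of_lt_of_le (lt_min hxh0 hx) hy.1
    apply intervalIntegral.integral_hasDerivAt_right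
    · exact (hcont.mono hsub).intervalIntegrable
    · exact hcont.stronglyMeasurableAtFilter isOpen_Ioi x hx
    · exact hcont.continuousAt (isOpen_Ioi.mem_nhds hx)
  have h0 : V1 κ xh xh = 0 := by simp [V1]
  have hc : ∀ x, 0 < x → ContinuousAt (V1 κ xh) x := fun x hx => (hd x hx).continuousAt
  have hA : StrictAntiOn (V1 κ xh) (Ioc 0 xh) := by
    apply strictAntiOn_of_deriv_neg (convex_Ioc 0 xh)
    · exact fun x hx => (hc x hx.1).continuousWithinAt
    · intro x hx
      rw [interior_Ioc] at hx
      rw [(hd x hx.1).deriv]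
      have := hanti (mem_Ici.2 hx.1.le) (mem_Ici.2 hxh0.le) hx.2
      exact div_neg_of_neg_of_pos (by linarith) hx.1
  have hM : StrictMonoOn (V1 κ xh) (Ici xh) := by
    apply strictMonoOn_of_deriv_pos (convex_Ici xh)
    · exact fun x hx => (hc x (hxh0.trans_le hx)).continuousWithinAt
    · intro x hx
      rw [interior_Ici] at hx
      have hx' : xh < x := hx
      have hx0 := hxh0.trans hx'
      rw [(hd x hx0).deriv]
      have := hanti (mem_Ici.2 hxh0.le) (mem_Ici.2 hx0.le) hx'
      exact div_pos (by linarith) hx0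
  have hl : ∃ a ∈ Ioo 0 xh, V₀ < V1 κ xh a := by
    obtain ⟨m, hm⟩ : ∃ m, m = xh / 2 := ⟨_, rfl⟩
    have hm0 : 0 < m := by linarith
    have hmx : m < xh := by linarith
    have hcp := hanti (mem_Ici.2 hm0.le) (mem_Ici.2 hxh0.le) hmx
    obtain ⟨c, hcd⟩ : ∃ c, c = κ m - κ xh := ⟨_, rfl⟩
    have hc0 : 0 < c := by linarith
    have hg : ∀ x, 0 < x →
        HasDerivAt (fun x => V1 κ xh x + c * Real.log x) ((κ xh - κ x) / x + c * x⁻¹) x :=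
      fun x hx => (hd x hx).add ((Real.hasDerivAt_log hx.ne').const_mul c)
    have hgA : AntitoneOn (fun x => V1 κ xh x + c * Real.log x) (Ioc 0 m) := by
      apply antitoneOn_of_deriv_nonpos (convex_Ioc 0 m)
      · exact fun x hx => (hg x hx.1).continuousAt.continuousWithinAt
      · intro x hx
        rw [interior_Ioc] at hx
        exact (hg x hx.1).differentiableAt.differentiableWithinAt
      · intro x hx
        rw [interior_Ioc] at hx
        rw [(hg x hx.1).deriv, ← div_eq_mul_inv, ← add_div]
        have := hanti (mem_Ici.2 hx.1.le) (mem_Ici.2 hm0.le) hx.2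
        exact div_nonpos_of_nonpos_of_nonneg (by linarith) hx.1.le
    have hVm : 0 < V1 κ xh m := by
      rw [← h0]; exact hA ⟨hm0, hmx.le⟩ ⟨hxh0, le_rfl⟩ hmx
    have he : Real.exp (-(V₀ / c)) < 1 := by
      rw [Real.exp_lt_one_iff]; have := div_pos hV hc0; linarith
    have hep := Real.exp_pos (-(V₀ / c))
    have ha0 : 0 < m * Real.exp (-(V₀ / c)) := mul_pos hm0 hep
    have ham : m * Real.exp (-(V₀ / c)) < m := by nlinarith
    refine ⟨_, ⟨ha0, ham.trans hmx⟩, ?_⟩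
    have h := hgA ⟨ha0, ham.le⟩ ⟨hm0, le_rfl⟩ ham.le
    simp only [] at h
    rw [Real.log_mul hm0.ne' hep.ne', Real.log_exp] at h
    have : c * (V₀ / c) = V₀ := by field_simp
    linarith
  have hu : ∃ b, xh < b ∧ V₀ < V1 κ xh b := by
    obtain ⟨m, hm⟩ : ∃ m, m = xh * 2 := ⟨_, rfl⟩
    have hm0 : 0 < m := by linarith
    have hmx : xh < m := by linarith
    have hcp := hanti (mem_Ici.2 hxh0.le) (mem_Ici.2 hm0.le) hmx
    obtain ⟨c, hcd⟩ : ∃ c, c = κ xh - κ m := ⟨_, rfl⟩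
    have hc0 : 0 < c := by linarith
    have hg : ∀ x, 0 < x →
        HasDerivAt (fun x => V1 κ xh x - c * Real.log x) ((κ xh - κ x) / x - c * x⁻¹) x :=
      fun x hx => (hd x hx).sub ((Real.hasDerivAt_log hx.ne').const_mul c)
    have hgM : MonotoneOn (fun x => V1 κ xh x - c * Real.log x) (Ici m) := by
      apply monotoneOn_of_deriv_nonneg (convex_Ici m)
      · exact fun x hx => (hg x (hm0.trans_le hx)).continuousAt.continuousWithinAt
      · intro x hx
        rw [interior_Ici] at hx
        exact (hg x (hm0.trans hx)).differentiableAt.differentiableWithinAt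
      · intro x hx
        rw [interior_Ici] at hx
        have hx' : m < x := hx
        have hx0 := hm0.trans hx'
        rw [(hg x hx0).deriv, ← div_eq_mul_inv, ← sub_div]
        have := hanti (mem_Ici.2 hm0.le) (mem_Ici.2 hx0.le) hx'
        exact div_nonneg (by linarith) hx0.le
    have hVm : 0 < V1 κ xh m := by
      rw [← h0]; exact hM (mem_Ici.2 le_rfl) (mem_Ici.2 hmx.le) hmx
    have he : 1 < Real.exp (V₀ / c) := by
      rw [Real.one_lt_exp_iff]; exact div_pos hV hc0
    have hep := Real.exp_pos (V₀ / c)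
    have ham : m < m * Real.exp (V₀ / c) := by nlinarith
    refine ⟨_, hmx.trans ham, ?_⟩
    have h := hgM (mem_Ici.2 le_rfl) (mem_Ici.2 ham.le) ham.le
    simp only [] at h
    rw [Real.log_mul hm0.ne' hep.ne', Real.log_exp] at h
    have : c * (V₀ / c) = V₀ := by field_simp
    linarith
  obtain ⟨a, ha, hVa⟩ := hl
  obtain ⟨b, hb, hVb⟩ := hu
  obtain ⟨xl, hxl, hVl⟩ := intermediate_value_Ioo' (f := V1 κ xh) ha.2.le
    (fun x hx => (hc x (ha.1.trans_le hx.1)).continuousWithinAt)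
    (show V₀ ∈ _ from ⟨by rw [h0]; exact hV, hVa⟩)
  obtain ⟨xu, hxu, hVu⟩ := intermediate_value_Ioo (f := V1 κ xh) hb.le
    (fun x hx => (hc x (hxh0.trans_le hx.1)).continuousWithinAt)
    (show V₀ ∈ _ from ⟨by rw [h0]; exact hV, hVb⟩)
  have hxl0 : 0 < xl := ha.1.trans hxl.1
  refine ⟨xl, xu, ⟨hxl0, hxl.2⟩, hxu.1, hVl, hVu, ?_⟩
  intro x hx hVx
  rcases le_total x xh with h | h
  · left
    exact hA.injOn ⟨hx, h⟩ ⟨hxl0, hxl.2.le⟩ (hVx.trans hVl.symm)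
  · right
    exact hM.injOn (mem_Ici.2 h) (mem_Ici.2 hxu.1.le) (hVx.trans hVu.symm)
end

section
/- Let ℒ be the second-order differential operator ℒφ(x,y) := φ_x(x,y)·x(Φ(y) − α + σ²(y)) + φ_y(x,y)·y(κ(x) − γ + σ²(y)) + (σ²(y)/2)(φ_{xx}(x,y)x² + φ_{yy}(x,y)y² + 2φ_{xy}(x,y)xy). Under Assumption A, for all (x,y) ∈ D := (0,∞) × (0,1), one has ℒV(x,y) = (σ²(y)/2)·( [κ(x̂) − κ(x) − xκ'(x)] + [Φ(y) − Φ(ŷ) + yΦ'(y)] ). -/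
open Set Filter MeasureTheory intervalIntegral Real

theorem aux_deriv (S : Set ℝ) (hS : IsOpen S) (hoc : S.OrdConnected) (g : ℝ → ℝ)
    (hg : ContinuousOn g S) (c : ℝ) (hc : c ∈ S) (x : ℝ) (hx : x ∈ S) :
    HasDerivAt (fun a => ∫ s in c..a, g s) (g x) x := by
  have hsub : Set.uIcc c x ⊆ S := hoc.uIcc_subset hc hx
  refine intervalIntegral.integral_hasDerivAt_right ((hg.mono hsub).intervalIntegrable) ?_
    (hg.continuousAt (hS.mem_nhds hx))
  exact hg.stronglyMeasurableAtFilter hS x hx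

theorem LV_formula
    (α γ : ℝ) (Φ Φ' Φ'' κ κ' κ'' : ℝ → ℝ)
    (hΦd : ∀ y ∈ Set.Ico (0:ℝ) 1, HasDerivAt Φ (Φ' y) y)
    (hΦd2 : ∀ y ∈ Set.Ico (0:ℝ) 1, HasDerivAt Φ' (Φ'' y) y)
    (hΦc : ContinuousOn Φ'' (Set.Ico (0:ℝ) 1))
    (hΦpos : ∀ y ∈ Set.Ico (0:ℝ) 1, 0 < Φ' y)
    (hΦconv : ∀ y ∈ Set.Ico (0:ℝ) 1, 0 ≤ Φ'' y)
    (hΦ0 : Φ 0 < α)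
    (hΦtop : Filter.Tendsto Φ (nhdsWithin 1 (Set.Iio 1)) Filter.atTop)
    (hκd : ∀ x ∈ Set.Ici (0:ℝ), HasDerivAt κ (κ' x) x)
    (hκd2 : ∀ x ∈ Set.Ici (0:ℝ), HasDerivAt κ' (κ'' x) x)
    (hκc : ContinuousOn κ'' (Set.Ici (0:ℝ)))
    (hκneg : ∀ x ∈ Set.Ici (0:ℝ), κ' x < 0)
    (hκ0 : γ < κ 0)
    (hκbot : Filter.Tendsto κ Filter.atTop Filter.atBot)
    (xh : ℝ) (hxh0 : 0 < xh) (hxh : κ xh = γ)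
    (yh : ℝ) (hyh0 : yh ∈ Set.Ioo (0:ℝ) 1) (hyh : Φ yh = α)
    (σ : ℝ → ℝ) (σ₀ : ℝ) (hσ₀ : 0 < σ₀)
    (hσ : ∀ y ∈ Set.Icc (0:ℝ) 1, 0 < σ y ∧ σ y ≤ σ₀)
 :
    ∀ x ∈ Set.Ioi (0:ℝ), ∀ y ∈ Set.Ioo (0:ℝ) 1,
      deriv (fun a => V1 κ xh a + V2 Φ yh y) x * (x * (Φ y - α + (σ y)^2)) +
      deriv (fun b => V1 κ xh x + V2 Φ yh b) y * (y * (κ x - γ + (σ y)^2)) +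
      (σ y)^2 / 2 *
        (deriv (deriv (fun a => V1 κ xh a + V2 Φ yh y)) x * x^2 +
         deriv (deriv (fun b => V1 κ xh x + V2 Φ yh b)) y * y^2 +
         2 * deriv (fun b => deriv (fun a => V1 κ xh a + V2 Φ yh b) x) y * (x * y))
      = (σ y)^2 / 2 * ((κ xh - κ x - x * κ' x) + (Φ y - Φ yh + y * Φ' y)) := by
  intro x hx y hy
  have hκ0 : ∀ z ∈ Set.Ioi (0:ℝ), HasDerivAt κ (κ' z) z := fun z hz => hκd z (Set.Ioi_subset_Ici_self hz)
  have hΦ0 : ∀ z ∈ Set.Ioo (0:ℝ) 1, HasDerivAt Φ (Φ' z) z := fun z hz => hΦd z ⟨hz.1.le, hz.2⟩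
  have d1 : ∀ z ∈ Set.Ioi (0:ℝ), HasDerivAt (fun s => (κ xh - κ s) / s)
      (((-κ' z) * z - (κ xh - κ z) * 1) / z ^ 2) z := fun z hz =>
    ((hκ0 z hz).const_sub (κ xh)).div (hasDerivAt_id z) (ne_of_gt hz)
  have d2 : ∀ z ∈ Set.Ioo (0:ℝ) 1, HasDerivAt (fun s => (Φ s - Φ yh) / s)
      ((Φ' z * z - (Φ z - Φ yh) * 1) / z ^ 2) z := fun z hz =>
    ((hΦ0 z hz).sub_const (Φ yh)).div (hasDerivAt_id z) (ne_of_gt hz.1)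
  have e1 : ∀ k : ℝ, ∀ z ∈ Set.Ioi (0:ℝ),
      deriv (fun a => V1 κ xh a + k) z = (κ xh - κ z) / z := fun k z hz =>
    ((aux_deriv _ isOpen_Ioi Set.ordConnected_Ioi _
      (fun w hw => (d1 w hw).continuousAt.continuousWithinAt) xh hxh0 z hz).add_const k).deriv
  have e2 : ∀ k : ℝ, ∀ z ∈ Set.Ioo (0:ℝ) 1,
      deriv (fun b => k + V2 Φ yh b) z = (Φ z - Φ yh) / z := fun k z hz =>
    ((aux_deriv _ isOpen_Ioo Set.ordConnected_Ioo _
      (fun w hw => (d2 w hw).continuousAt.continuousWithinAt) yh hyh0 z hz).const_add k).deriv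
  have f1 : deriv (deriv (fun a => V1 κ xh a + V2 Φ yh y)) x
      = ((-κ' x) * x - (κ xh - κ x) * 1) / x ^ 2 := by
    rw [Filter.EventuallyEq.deriv_eq (f := fun s => (κ xh - κ s) / s)]
    · exact (d1 x hx).deriv
    · filter_upwards [isOpen_Ioi.mem_nhds hx] with z hz using e1 _ z hz
  have f2 : deriv (deriv (fun b => V1 κ xh x + V2 Φ yh b)) y
      = (Φ' y * y - (Φ y - Φ yh) * 1) / y ^ 2 := by
    rw [Filter.EventuallyEq.deriv_eq (f := fun s => (Φ s - Φ yh) / s)]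
    · exact (d2 y hy).deriv
    · filter_upwards [isOpen_Ioo.mem_nhds hy] with z hz using e2 _ z hz
  have f3 : deriv (fun b => deriv (fun a => V1 κ xh a + V2 Φ yh b) x) y = 0 := by
    have : (fun b => deriv (fun a => V1 κ xh a + V2 Φ yh b) x)
        = fun _ => (κ xh - κ x) / x := funext fun b => e1 _ x hx
    rw [this]
    simp
  rw [f1, f2, f3, e1 _ x hx, e2 _ y hy, ← hxh, ← hyh]
  have hx0 : x ≠ 0 := ne_of_gt hx
  have hy0 : y ≠ 0 := ne_of_gt hy.1
  field_simp
  ring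
end

section
/- In the explicit Goodwin model with κ(x) = (1 − x)/ν, Φ(y) = φ₁/(1 − y)² + φ₀, and volatility σ(y) = σ₀(1 − y), under the parameter conditions ν > 0, γ > 0, 0 < νγ < 1, φ₁ > 0, α − φ₀ > φ₁, and σ₀ > 0, the growth conditions hold: there exist constants K, k > 0 such that σ²(y)Φ'(y) = 2σ₀²φ₁/(1 − y) ≤ K·V₂(y) + k for all y ∈ (0,1), and −κ(x) − xκ'(x) = (2x − 1)/ν ≤ K·V₁(x) + k for all x > 0. -/
open Set Filter MeasureTheory intervalIntegral Real

lemma aux_V1 (ν a x : ℝ) (hν : 0 < ν) (ha : 0 < a) (hx : 0 < x) :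
    V1 (fun x => (1 - x) / ν) a x = (x - a * log x) / ν - (a - a * log a) / ν := by
  unfold V1
  have hpos : ∀ s ∈ uIcc a x, 0 < s := fun s hs => lt_of_lt_of_le (lt_min ha hx) hs.1
  refine integral_eq_sub_of_hasDerivAt (f := fun s => (s - a * log s) / ν) ?_ ?_
  · intro s hs
    have h := hpos s hs
    refine HasDerivAt.congr_deriv
      (((hasDerivAt_id s).sub ((hasDerivAt_log h.ne').const_mul a)).div_const ν) ?_
    field_simp
    ring
  · apply ContinuousOn.intervalIntegrable
    intro s hs
    have h := (hpos s hs).ne'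
    apply ContinuousAt.continuousWithinAt
    fun_prop (disch := assumption)

lemma aux_V2 (φ₁ φ₀ c a y : ℝ) (ha : 0 < a) (ha1 : a < 1) (hy : 0 < y) (hy1 : y < 1)
    (hc : φ₁ / (1 - a) ^ 2 = c) :
    V2 (fun y => φ₁ / (1 - y)^2 + φ₀) a y =
      (φ₁ * (log y - log (1 - y) + (1 - y)⁻¹) - c * log y)
      - (φ₁ * (log a - log (1 - a) + (1 - a)⁻¹) - c * log a) := by
  unfold V2
  have hpos : ∀ s ∈ uIcc a y, 0 < s := fun s hs => lt_of_lt_of_le (lt_min ha hy) hs.1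
  have hlt : ∀ s ∈ uIcc a y, 0 < 1 - s := fun s hs =>
    sub_pos.2 (lt_of_le_of_lt hs.2 (max_lt ha1 hy1))
  refine integral_eq_sub_of_hasDerivAt
    (f := fun s => φ₁ * (log s - log (1 - s) + (1 - s)⁻¹) - c * log s) ?_ ?_
  · intro s hs
    have h := (hpos s hs).ne'
    have h1 := (hlt s hs).ne'
    have hd : HasDerivAt (fun s : ℝ => 1 - s) (-1) s := by
      simpa using (hasDerivAt_id s).const_sub 1
    have hl := hasDerivAt_log h
    refine HasDerivAt.congr_deriv
      ((((hl.sub (hd.log h1)).add (hd.inv h1)).const_mul φ₁).sub (hl.const_mul c)) ?_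
    simp only [hc]
    field_simp
    ring
  · apply ContinuousOn.intervalIntegrable
    intro s hs
    have h := (hpos s hs).ne'
    have h1 := (hlt s hs).ne'
    have h2 : (1 - s) ^ 2 ≠ 0 := pow_ne_zero 2 h1
    apply ContinuousAt.continuousWithinAt
    fun_prop (disch := assumption)

theorem explicit_model_growth_conditions
    (ν γ α φ₀ φ₁ σ₀ : ℝ) (hν : 0 < ν) (hγ : 0 < γ) (hνγ : ν * γ < 1)
    (hφ₁ : 0 < φ₁) (hαφ : φ₁ < α - φ₀) (hσ₀ : 0 < σ₀) :
    let κ : ℝ → ℝ := fun x => (1 - x) / ν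
    let Φ : ℝ → ℝ := fun y => φ₁ / (1 - y)^2 + φ₀
    let σ : ℝ → ℝ := fun y => σ₀ * (1 - y)
    let xh : ℝ := 1 - ν * γ
    let yh : ℝ := 1 - Real.sqrt (φ₁ / (α - φ₀))
    ∃ K k : ℝ, 0 < K ∧ 0 < k ∧
      (∀ y ∈ Set.Ioo (0:ℝ) 1,
        (σ y)^2 * deriv Φ y = 2 * σ₀^2 * φ₁ / (1 - y) ∧
        (σ y)^2 * deriv Φ y ≤ K * V2 Φ yh y + k) ∧
      (∀ x : ℝ, 0 < x →
        -κ x - x * deriv κ x = (2 * x - 1) / ν ∧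
        -κ x - x * deriv κ x ≤ K * V1 κ xh x + k) := by
  intro κ Φ σ xh yh
  have hc0 : 0 < α - φ₀ := hφ₁.trans hαφ
  have hq : 0 < φ₁ / (α - φ₀) := div_pos hφ₁ hc0
  have hq1 : φ₁ / (α - φ₀) < 1 := (div_lt_one hc0).2 hαφ
  have hs0 : 0 < √(φ₁ / (α - φ₀)) := Real.sqrt_pos.2 hq
  have hs1 : √(φ₁ / (α - φ₀)) < 1 := by
    rw [Real.sqrt_lt' one_pos]; simpa using hq1
  have hy0 : 0 < yh := by simp only [yh]; linarith
  have hy1 : yh < 1 := by simp only [yh]; linarith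
  have hνγ0 : 0 < ν * γ := mul_pos hν hγ
  have hx0 : 0 < xh := by simp only [xh]; linarith
  have hc : φ₁ / (1 - yh) ^ 2 = α - φ₀ := by
    have : (1 - yh) ^ 2 = φ₁ / (α - φ₀) := by
      simp only [yh, sub_sub_cancel]; exact Real.sq_sqrt hq.le
    rw [this]; field_simp
  have e1 : ∀ x, 0 < x → V1 κ xh x = _ := fun x hx => aux_V1 ν xh x hν hx0 hx
  have e2 : ∀ y, 0 < y → y < 1 → V2 Φ yh y = _ :=
    fun y h h' => aux_V2 φ₁ φ₀ (α - φ₀) yh y hy0 hy1 h h' hc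
  generalize hA : (xh - xh * log xh) / ν = A at e1
  generalize hB : φ₁ * (log yh - log (1 - yh) + (1 - yh)⁻¹) - (α - φ₀) * log yh = B at e2
  obtain ⟨K, hK⟩ : ∃ K, K = 2 * σ₀ ^ 2 + 2 / (ν * γ) := ⟨_, rfl⟩
  have hK1 : 2 * σ₀ ^ 2 ≤ K := by rw [hK]; linarith [div_pos two_pos hνγ0]
  have hK2 : 2 / (ν * γ) ≤ K := by rw [hK]; nlinarith
  have hK0 : 0 < K := lt_of_lt_of_le (by positivity) hK1
  have hA' := mul_le_mul_of_nonneg_left (le_abs_self A) hK0.le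
  have hB' := mul_le_mul_of_nonneg_left (le_abs_self B) hK0.le
  have hA0 : 0 ≤ K * |A| := by positivity
  have hB0 : 0 ≤ K * |B| := by positivity
  refine ⟨K, K * |A| + K * |B| + 1, hK0, by positivity, ?_, ?_⟩
  · rintro y ⟨h0, h1⟩
    have hy : 0 < 1 - y := sub_pos.2 h1
    have hE : (σ y)^2 * deriv Φ y = 2 * σ₀^2 * φ₁ / (1 - y) := by
      have hd : HasDerivAt (fun s : ℝ => 1 - s) (-1) y := by
        simpa using (hasDerivAt_id y).const_sub 1
      have hD : HasDerivAt Φ (2 * φ₁ / (1 - y) ^ 3) y := by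
        refine HasDerivAt.congr_deriv
          (((hasDerivAt_const y φ₁).div (hd.pow 2) (pow_ne_zero 2 hy.ne')).add_const φ₀) ?_
        simp
        field_simp
      rw [hD.deriv]
      simp only [σ]
      field_simp
    refine ⟨hE, ?_⟩
    rw [hE, e2 y h0 h1]
    have l1 : log y ≤ 0 := Real.log_nonpos h0.le h1.le
    have l2 : log (1 - y) ≤ 0 := Real.log_nonpos hy.le (by linarith)
    have hF : φ₁ * (1 - y)⁻¹ ≤ φ₁ * (log y - log (1 - y) + (1 - y)⁻¹) - (α - φ₀) * log y := by
      nlinarith [mul_nonneg hφ₁.le (neg_nonneg.2 l2),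
        mul_nonneg (sub_nonneg.2 hαφ.le) (neg_nonneg.2 l1)]
    have hp : 0 ≤ φ₁ * (1 - y)⁻¹ := by positivity
    have := mul_le_mul hK1 hF hp hK0.le
    have e : 2 * σ₀^2 * φ₁ / (1 - y) = 2 * σ₀ ^ 2 * (φ₁ * (1 - y)⁻¹) := by
      rw [div_eq_mul_inv]; ring
    rw [e, mul_sub]
    linarith
  · intro x hx
    have hE : -κ x - x * deriv κ x = (2 * x - 1) / ν := by
      have hD : HasDerivAt κ (-1 / ν) x := by
        simpa using ((hasDerivAt_id x).const_sub 1).div_const ν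
      rw [hD.deriv]
      simp only [κ]
      field_simp
      ring
    refine ⟨hE, ?_⟩
    rw [hE, e1 x hx]
    have hl := Real.log_le_sub_one_of_pos hx
    have hG : γ * x ≤ (x - xh * log x) / ν := by
      rw [le_div_iff₀ hν]
      have h1 := mul_le_mul_of_nonneg_left hl hx0.le
      have h2 : ν * γ = 1 - xh := by simp only [xh]; ring
      have h3 : γ * x * ν = (1 - xh) * x := by rw [← h2]; ring
      rw [h3]; linarith
    have := mul_le_mul hK2 hG (by positivity) hK0.le
    have e : 2 / (ν * γ) * (γ * x) = 2 * x / ν := by field_simp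
    rw [e] at this
    have h4 : (2 * x - 1) / ν ≤ 2 * x / ν := by gcongr; linarith
    rw [mul_sub]
    linarith
end
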